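/- arXiv:math/0503155 — 3 statements merged into one kernel-verified Lean document; each statement's English description precedes it below -/
import Mathlib

section
/- Let ℙ be a multiplicative subsemigroup of the positive integers. Every ℙ-torsion-free ℙ-unperforated cone admits an order-embedding into a ℙ-torsion-free ℙ-unperforated normally divisible refinement cone. -/
universe u

/-- Conical commutative monoid ("cone"): `x + y = 0` implies `x = y = 0`. -/
def IsConical (M : Type u) [AddCommMonoid M] : Prop :=
  ∀ x y : M, x + y = 0 → x = 0 ∧ y = 0

/-- Algebraic preorder: `x ≤ y` iff `∃ z, x + z = y`. -/
def AlgLE {M : Type u} [AddCommMonoid M] (x y : M) : Prop :=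
  ∃ z : M, x + z = y

/-- Refinement monoid. -/
def IsRefinementMonoid (M : Type u) [AddCommMonoid M] : Prop :=
  ∀ a₀ a₁ b₀ b₁ : M, a₀ + a₁ = b₀ + b₁ →
    ∃ c₀₀ c₀₁ c₁₀ c₁₁ : M,
      a₀ = c₀₀ + c₀₁ ∧ a₁ = c₁₀ + c₁₁ ∧ b₀ = c₀₀ + c₁₀ ∧ b₁ = c₀₁ + c₁₁

/-- Unitary homomorphism: injective, cofinal image, and `f a₀ + b = f a₁ → b ∈ range f`. -/
def IsUnitary {A : Type u} {B : Type u} [AddCommMonoid A] [AddCommMonoid B]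
    (f : A →+ B) : Prop :=
  Function.Injective f ∧
  (∀ b : B, ∃ a : A, AlgLE b (f a)) ∧
  (∀ a₀ a₁ : A, ∀ b : B, f a₀ + b = f a₁ → b ∈ Set.range f)

/-- Strongly unitary homomorphism. -/
def IsStronglyUnitary {A : Type u} {B : Type u} [AddCommMonoid A] [AddCommMonoid B]
    (f : A →+ B) : Prop :=
  IsUnitary f ∧ ∀ m : ℕ, 0 < m → ∀ b : B, m • b ∈ Set.range f → b ∈ Set.range f

/-- Normally divisible commutative monoid. -/
def IsNormallyDivisible (M : Type u) [AddCommMonoid M] : Prop :=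
  ∀ p : ℕ, 0 < p → ∀ X : Finset M, ∀ a : M,
    ∃ u : M, p • u = a ∧ ∀ x ∈ X, ∀ y ∈ X, x + a = y + a → x + u = y + u

/-- Order-embedding of commutative monoids (w.r.t. the algebraic preorders). -/
def IsOrderEmbeddingHom {A : Type u} {B : Type u} [AddCommMonoid A] [AddCommMonoid B]
    (f : A →+ B) : Prop :=
  Function.Injective f ∧ ∀ x y : A, AlgLE x y ↔ AlgLE (f x) (f y)

/-- Simple commutative monoid: every `u ≰ 0` is an order-unit. -/
def IsSimpleMonoid (M : Type u) [AddCommMonoid M] : Prop :=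
  ∀ u : M, ¬ AlgLE u 0 → ∀ x : M, ∃ n : ℕ, 0 < n ∧ AlgLE x (n • u)

/-- Weak sum decomposition axiom (WSD). -/
def WSD (M : Type u) [AddCommMonoid M] : Prop :=
  ∀ a₀ a₁ b c : M, a₀ + a₁ + c = b + c →
    ∃ x₀ x₁ : M, a₀ + c = x₀ + c ∧ a₁ + c = x₁ + c ∧ b = x₀ + x₁

/-- `a ∝ b` : `a ≤ n • b` for some positive integer `n`. -/
def Propto {M : Type u} [AddCommMonoid M] (a b : M) : Prop :=
  ∃ n : ℕ, 0 < n ∧ AlgLE a (n • b)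

/-- `a ≍ b` : `a ∝ b` and `b ∝ a`. -/
def Asymp {M : Type u} [AddCommMonoid M] (a b : M) : Prop :=
  Propto a b ∧ Propto b a

/-- Cancellative commutative monoid. -/
def IsCancellativeMonoid (M : Type u) [AddCommMonoid M] : Prop :=
  ∀ x y z : M, x + z = y + z → x = y

/-- Separative commutative monoid. -/
def IsSeparative (M : Type u) [AddCommMonoid M] : Prop :=
  ∀ x y : M, 2 • x = x + y → x + y = 2 • y → x = y

/-- Stably finite commutative monoid. -/
def IsStablyFinite (M : Type u) [AddCommMonoid M] : Prop :=
  ∀ x y : M, x + y = y → x = 0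

/-- Quasi-divisible commutative monoid. -/
def IsQuasiDivisible (M : Type u) [AddCommMonoid M] : Prop :=
  ∀ x : M, ∃ u v : M, 2 • u + 3 • v = x

/-- `ℙ`-torsion-free commutative monoid. -/
def PTorsionFree (P : Set ℕ) (M : Type u) [AddCommMonoid M] : Prop :=
  ∀ p ∈ P, ∀ x y : M, p • x = p • y → x = y

/-- `ℙ`-unperforated commutative monoid (w.r.t. the algebraic preorder). -/
def PUnperforated (P : Set ℕ) (M : Type u) [AddCommMonoid M] : Prop :=
  ∀ p ∈ P, ∀ x y : M, AlgLE (p • x) (p • y) → AlgLE x y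

theorem IsConical.eq_zero_of_nsmul_eq_zero {M : Type u} [AddCommMonoid M] (hM : IsConical M)
    {n : ℕ} (hn : n ≠ 0) {x : M} (h : n • x = 0) : x = 0 := by
  obtain ⟨m, rfl⟩ := Nat.exists_eq_succ_of_ne_zero hn
  rw [succ_nsmul] at h
  exact (hM _ _ h).2

/-- The syntactic congruence of the partial homomorphism `β e ↦ χ e`. -/
def syntacticCon {M E T : Type*} [AddCommMonoid M] [AddCommMonoid E] [AddCommMonoid T]
    (β : E →+ T) (χ : E →+ M) : AddCon T where
  r t t' := ∀ s m, (∃ e, β e = t + s ∧ χ e = m) ↔ ∃ e, β e = t' + s ∧ χ e = m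
  iseqv := ⟨fun _ _ _ => Iff.rfl, fun h s m => (h s m).symm,
    fun h h' s m => (h s m).trans (h' s m)⟩
  add' := by
    intro w x y z h h' s m
    have h₁ := h (y + s) m
    have h₂ := h' (x + s) m
    rw [← add_assoc, ← add_assoc] at h₁ h₂
    rw [h₁, add_comm x y, h₂, add_comm z x]

/-- A conical monoid `M` that is the target of a partial homomorphism defined on a unitary
submonoid of `T` extends to a quotient of `T` in which this homomorphism becomes an equality. -/
theorem IsConical.exists_quotient_extension {M : Type u} {E T : Type u} [AddCommMonoid M]
    [AddCommMonoid E] [AddCommMonoid T] (hT : IsConical T) (β : E →+ T)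
    (χ : E →+ M) (i : M →+ E) (hi : ∀ x, χ (i x) = x)
    (hβχ : ∀ e e', β e = β e' → χ e = χ e')
    (hβ : ∀ e s e', β e + s = β e' → s ∈ Set.range β) (hχ : ∀ e, χ e = 0 → β e = 0) :
    ∃ (N : Type u) (_ : AddCommMonoid N) (π : T →+ N), IsConical N ∧
      IsOrderEmbeddingHom (π.comp (β.comp i)) ∧ (∀ e, π (β e) = π (β (i (χ e)))) ∧
      ∀ u x y, (∀ e s, β e = u + s → x + χ e = y + χ e) →
        π (β (i x)) + π u = π (β (i y)) + π u := by
  refine ⟨(syntacticCon β χ).Quotient, inferInstance, (syntacticCon β χ).mk', ?_, ⟨?_, ?_⟩, ?_, ?_⟩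
  · intro x y
    induction x using AddCon.induction_on with | _ x =>
    induction y using AddCon.induction_on with | _ y =>
    intro h
    have h : (syntacticCon β χ) (x + y) 0 := (AddCon.eq _).1 h
    obtain ⟨e, he, he'⟩ := (h 0 0).2 ⟨0, by simp⟩
    rw [hχ e he', add_zero] at he
    obtain ⟨rfl, rfl⟩ := hT _ _ he.symm
    exact ⟨rfl, rfl⟩
  · intro x y h
    have h : (syntacticCon β χ) (β (i x)) (β (i y)) := (AddCon.eq _).1 h
    obtain ⟨e, he, he'⟩ := (h 0 x).1 ⟨i x, by simp [hi]⟩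
    rw [add_zero] at he
    rw [← he', hβχ _ _ he, hi]
  · intro x y
    constructor
    · rintro ⟨z, rfl⟩
      exact ⟨_, (map_add _ _ _).symm⟩
    · rintro ⟨z, h⟩
      induction z using AddCon.induction_on with | _ z =>
      have h : (syntacticCon β χ) (β (i x) + z) (β (i y)) := (AddCon.eq _).1 h
      obtain ⟨e, he, he'⟩ := (h 0 y).2 ⟨i y, by simp [hi]⟩
      rw [add_zero] at he
      obtain ⟨e', rfl⟩ := hβ _ _ _ he.symm
      rw [← map_add] at he
      refine ⟨χ e', ?_⟩
      rw [← he', hβχ _ _ he, map_add, hi]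
  · intro e
    refine (AddCon.eq _).2 fun s m => ?_
    constructor
    all_goals
      rintro ⟨e', h, rfl⟩
      obtain ⟨s, rfl⟩ := hβ _ _ _ h.symm
      rw [← map_add] at h
      refine ⟨_, map_add _ _ _, ?_⟩
      rw [hβχ _ _ h]
      simp [hi]
  · intro u x y h
    have key : ∀ x y, (∀ e s, β e = u + s → x + χ e = y + χ e) → ∀ s m,
        (∃ e, β e = β (i x) + u + s ∧ χ e = m) → ∃ e, β e = β (i y) + u + s ∧ χ e = m := by
      rintro x y h s _ ⟨e, he, rfl⟩
      rw [add_assoc] at he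
      obtain ⟨e', he'⟩ := hβ _ _ _ he.symm
      rw [← he', ← map_add] at he
      refine ⟨i y + e', by rw [map_add, he', add_assoc], ?_⟩
      rw [hβχ _ _ he, map_add, map_add, hi, hi, h e' s he']
    exact (AddCon.eq _).2 fun s m => ⟨key x y h s m, key y x (fun e s he => (h e s he).symm) s m⟩

/-- Simultaneous version of `IsConical.exists_quotient_extension`, for a family of partial
homomorphisms from unitary submonoids of a conical monoid `B`. -/
theorem IsConical.exists_family_extension {M : Type u} [AddCommMonoid M] (hM : IsConical M)
    {K : Type u} {E B : Type} [AddCommMonoid E] [AddCommMonoid B] (hB : IsConical B)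
    (β : K → E →+ B) (χ : K → E →+ M) (hβχ : ∀ k e e', β k e = β k e' → χ k e = χ k e')
    (hβ : ∀ k e s e', β k e + s = β k e' → s ∈ Set.range (β k))
    (hχ : ∀ k e, χ k e = 0 → e = 0) :
    ∃ (N : Type u) (_ : AddCommMonoid N) (j : M →+ N) (π : K → B →+ N), IsConical N ∧
      IsOrderEmbeddingHom j ∧ (∀ k e, π k (β k e) = j (χ k e)) ∧
      ∀ k u x y, (∀ e s, β k e = u + s → x + χ k e = y + χ k e) →
        j x + π k u = j y + π k u := by
  classical
  let βs : (Π₀ _ : K, E) →+ Π₀ _ : K, B := DFinsupp.mapRange.addMonoidHom β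
  let χs : (Π₀ _ : K, E) →+ M := DFinsupp.sumAddHom χ
  have hβs : ∀ e k, βs e k = β k (e k) := fun _ _ => rfl
  have hχs : ∀ e k, χs e = χ k (e k) + χs (e.erase k) := by
    intro e k
    conv_lhs => rw [← DFinsupp.single_add_erase k e]
    rw [map_add]
    congr 1
    exact DFinsupp.sumAddHom_single _ _ _
  have hχs' : ∀ e, χs e =
      DFinsupp.sumAddHom (fun _ => AddMonoidHom.id M) (DFinsupp.mapRange.addMonoidHom χ e) := by
    suffices χs = (DFinsupp.sumAddHom (fun _ => AddMonoidHom.id M)).comp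
        (DFinsupp.mapRange.addMonoidHom χ) from fun e => DFunLike.congr_fun this e
    ext k e
    simp [χs]
  have key := IsConical.exists_quotient_extension (M := M) (E := M × Π₀ _ : K, E)
    (T := M × Π₀ _ : K, B) ?_ ((AddMonoidHom.id M).prodMap βs) ((AddMonoidHom.id M).coprod χs)
    (AddMonoidHom.inl _ _) (by simp) ?_ ?_ ?_
  · obtain ⟨N, _, π, hN, hj, hrel, hnorm⟩ := key
    refine ⟨N, _, _,
      fun k => π.comp ((AddMonoidHom.inr _ _).comp (DFinsupp.singleAddHom (fun _ => B) k)),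
      hN, hj, ?_, ?_⟩
    · intro k e
      have h := hrel (0, DFinsupp.single k e)
      simpa [βs, χs] using h
    · intro k u x y h
      refine hnorm (0, DFinsupp.single k u) x y ?_
      rintro ⟨m, e⟩ ⟨m', s⟩ h'
      have h₂ : βs e = DFinsupp.single k u + s := congrArg Prod.snd h'
      have h₃ := h (e k) (s k) (by rw [← hβs, h₂]; simp)
      have h₄ : ∀ z : M, z + (m + χs e) = (z + χ k (e k)) + (m + χs (e.erase k)) := by
        intro z
        rw [hχs e k]
        abel
      simp only [AddMonoidHom.coprod_apply, AddMonoidHom.id_apply]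
      rw [h₄, h₄, h₃]
  · rintro ⟨m, b⟩ ⟨m', b'⟩ h
    have h₁ := hM m m' (congrArg Prod.fst h)
    have h₂ : b + b' = 0 := congrArg Prod.snd h
    have h₃ : ∀ k, b k = 0 ∧ b' k = 0 := fun k => hB _ _ (DFunLike.congr_fun h₂ k)
    exact ⟨Prod.ext h₁.1 (DFinsupp.ext fun k => (h₃ k).1),
      Prod.ext h₁.2 (DFinsupp.ext fun k => (h₃ k).2)⟩
  · rintro ⟨m, e⟩ ⟨m', e'⟩ h
    have h₁ : m = m' := congrArg Prod.fst h
    have h₂ : βs e = βs e' := congrArg Prod.snd h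
    have h₃ : DFinsupp.mapRange.addMonoidHom χ e = DFinsupp.mapRange.addMonoidHom χ e' :=
      DFinsupp.ext fun k => hβχ k _ _ (DFunLike.congr_fun h₂ k)
    simp [h₁, hχs', h₃]
  · rintro ⟨m, e⟩ ⟨m', s⟩ ⟨m'', e'⟩ h
    have h₂ : βs e + s = βs e' := congrArg Prod.snd h
    have h₃ : ∀ k, s k ∈ Set.range (β k) := fun k => hβ k _ _ _ (DFunLike.congr_fun h₂ k)
    have h₄ : ∀ k, ∃ g : B → E, g 0 = 0 ∧ ∀ b ∈ Set.range (β k), β k (g b) = b := by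
      intro k
      choose! g hg using fun b (hb : b ∈ Set.range (β k)) => hb
      refine ⟨fun b => if b = 0 then 0 else g b, if_pos rfl, fun b hb => ?_⟩
      by_cases hb0 : b = 0
      · simp [hb0]
      · simpa [hb0] using hg b hb
    choose g hg0 hg using h₄
    refine ⟨(m', DFinsupp.mapRange g hg0 s), Prod.ext rfl (DFinsupp.ext fun k => ?_)⟩
    exact hg k _ (h₃ k)
  · rintro ⟨m, e⟩ h
    obtain ⟨rfl, h₁⟩ := hM m (χs e) h
    have h₂ : e = 0 := DFinsupp.ext fun k => hχ k _ (hM _ _ ((hχs e k).symm.trans h₁)).1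
    simp [h₂]

theorem IsConical.exists_refinement_extension {M : Type u} [AddCommMonoid M] (hM : IsConical M) :
    ∃ (N : Type u) (_ : AddCommMonoid N) (j : M →+ N), IsConical N ∧ IsOrderEmbeddingHom j ∧
      ∀ a₀ a₁ b₀ b₁ : M, a₀ + a₁ = b₀ + b₁ → ∃ c₀₀ c₀₁ c₁₀ c₁₁ : N,
        j a₀ = c₀₀ + c₀₁ ∧ j a₁ = c₁₀ + c₁₁ ∧ j b₀ = c₀₀ + c₁₀ ∧ j b₁ = c₀₁ + c₁₁ := by
  let K : Type u := {q : (M × M) × M × M // q.1.1 + q.1.2 = q.2.1 + q.2.2 ∧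
    (q.1.1 ≠ 0 ∧ q.1.2 ≠ 0) ∧ q.2.1 ≠ 0 ∧ q.2.2 ≠ 0}
  let β : (ℕ × ℕ) × ℕ × ℕ →+ (ℕ × ℕ) × ℕ × ℕ :=
    { toFun := fun e => ((e.1.1 + e.2.1, e.1.1 + e.2.2), (e.1.2 + e.2.1, e.1.2 + e.2.2))
      map_zero' := rfl
      map_add' := fun x y => by ext <;> simp <;> ring }
  let χ : K → (ℕ × ℕ) × ℕ × ℕ →+ M := fun q =>
    { toFun := fun e => (e.1.1 • q.1.1.1 + e.1.2 • q.1.1.2) + (e.2.1 • q.1.2.1 + e.2.2 • q.1.2.2)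
      map_zero' := by simp
      map_add' := fun x y => by simp only [Prod.fst_add, Prod.snd_add, add_nsmul]; abel }
  have key := hM.exists_family_extension (K := K)
    (E := (ℕ × ℕ) × ℕ × ℕ) (B := (ℕ × ℕ) × ℕ × ℕ) ?_ (fun _ => β) χ ?_ ?_ ?_
  · obtain ⟨N, _, j, π, hN, hj, hrel, -⟩ := key
    refine ⟨N, _, j, hN, hj, fun a₀ a₁ b₀ b₁ h => ?_⟩
    by_cases ha₀ : a₀ = 0
    · subst ha₀
      exact ⟨0, 0, j b₀, j b₁, by simp, by rw [← map_add, ← h, zero_add], by simp, by simp⟩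
    by_cases ha₁ : a₁ = 0
    · subst ha₁
      exact ⟨j b₀, j b₁, 0, 0, by rw [← map_add, ← h, add_zero], by simp, by simp, by simp⟩
    by_cases hb₀ : b₀ = 0
    · subst hb₀
      exact ⟨0, j a₀, 0, j a₁, by simp, by simp, by simp, by rw [← map_add, h, zero_add]⟩
    by_cases hb₁ : b₁ = 0
    · subst hb₁
      exact ⟨j a₀, 0, j a₁, 0, by simp, by simp, by rw [← map_add, h, add_zero], by simp⟩
    let q : K := ⟨((a₀, a₁), (b₀, b₁)), h, ⟨ha₀, ha₁⟩, hb₀, hb₁⟩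
    refine ⟨π q ((1, 0), (0, 0)), π q ((0, 1), (0, 0)), π q ((0, 0), (1, 0)),
      π q ((0, 0), (0, 1)), ?_, ?_, ?_, ?_⟩ <;> rw [← map_add]
    · simpa [β, χ, q] using (hrel q ((1, 0), (0, 0))).symm
    · simpa [β, χ, q] using (hrel q ((0, 1), (0, 0))).symm
    · simpa [β, χ, q] using (hrel q ((0, 0), (1, 0))).symm
    · simpa [β, χ, q] using (hrel q ((0, 0), (0, 1))).symm
  · rintro ⟨⟨x, y⟩, z, w⟩ ⟨⟨x', y'⟩, z', w'⟩ h
    simp only [Prod.ext_iff, Prod.fst_add, Prod.snd_add, Prod.fst_zero, Prod.snd_zero] at h ⊢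
    omega
  · intro q
    have key : ∀ e e', β e = β e' → e.1.1 ≤ e'.1.1 → χ q e = χ q e' := by
      rintro ⟨⟨x, y⟩, z, w⟩ ⟨⟨x', y'⟩, z', w'⟩ h hle
      obtain ⟨d, hd⟩ := Nat.exists_eq_add_of_le hle
      simp only [β, AddMonoidHom.coe_mk, ZeroHom.coe_mk, Prod.mk.injEq] at h hd
      obtain ⟨rfl, rfl, rfl, rfl⟩ : x' = x + d ∧ y' = y + d ∧ z = z' + d ∧ w = w' + d := by
        omega
      simp only [χ, AddMonoidHom.coe_mk, ZeroHom.coe_mk]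
      calc _ = x • q.1.1.1 + y • q.1.1.2 + (z' • q.1.2.1 + w' • q.1.2.2) +
              d • (q.1.2.1 + q.1.2.2) := by simp only [add_nsmul, nsmul_add]; abel
        _ = x • q.1.1.1 + y • q.1.1.2 + (z' • q.1.2.1 + w' • q.1.2.2) +
              d • (q.1.1.1 + q.1.1.2) := by rw [q.2.1]
        _ = _ := by simp only [add_nsmul, nsmul_add]; abel
    intro e e' h
    rcases le_total e.1.1 e'.1.1 with hle | hle
    · exact key e e' h hle
    · exact (key e' e h.symm hle).symm
  · rintro - ⟨⟨x, y⟩, z, w⟩ ⟨⟨s₀₀, s₀₁⟩, s₁₀, s₁₁⟩ ⟨⟨x', y'⟩, z', w'⟩ h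
    simp only [β, AddMonoidHom.coe_mk, ZeroHom.coe_mk, Prod.mk_add_mk, Prod.mk.injEq] at h
    refine ⟨((min s₀₀ s₀₁, min s₁₀ s₁₁), (s₀₀ - s₀₁, s₀₁ - s₀₀)), ?_⟩
    simp only [β, AddMonoidHom.coe_mk, ZeroHom.coe_mk, Prod.mk.injEq]
    omega
  · rintro q ⟨⟨x, y⟩, z, w⟩ h
    obtain ⟨-, ⟨ha₀, ha₁⟩, hb₀, hb₁⟩ := q.2
    have key : ∀ (n : ℕ) (m : M), m ≠ 0 → n • m = 0 → n = 0 := fun n m hm hn => by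
      by_contra hn0
      exact hm (hM.eq_zero_of_nsmul_eq_zero hn0 hn)
    obtain ⟨h₁, h₂⟩ := hM _ _ h
    obtain ⟨h₃, h₄⟩ := hM _ _ h₁
    obtain ⟨h₅, h₆⟩ := hM _ _ h₂
    exact Prod.ext (Prod.ext (key _ _ ha₀ h₃) (key _ _ ha₁ h₄))
      (Prod.ext (key _ _ hb₀ h₅) (key _ _ hb₁ h₆))

theorem IsConical.exists_division_extension {M : Type u} [AddCommMonoid M] (hM : IsConical M) :
    ∃ (N : Type u) (_ : AddCommMonoid N) (j : M →+ N), IsConical N ∧ IsOrderEmbeddingHom j ∧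
      ∀ p : ℕ, 0 < p → ∀ a : M, ∃ u : N, p • u = j a ∧
        ∀ x y : M, x + a = y + a → j x + u = j y + u := by
  let K : Type u := {q : ℕ × M // 0 < q.1 ∧ q.2 ≠ 0}
  have key := hM.exists_family_extension (K := K)
    (E := ℕ) (B := ℕ) ?_ (fun q => nsmulAddMonoidHom q.1.1) (fun q => multiplesHom M q.1.2) ?_ ?_ ?_
  · obtain ⟨N, _, j, π, hN, hj, hrel, hnorm⟩ := key
    refine ⟨N, _, j, hN, hj, fun p hp a => ?_⟩
    by_cases ha : a = 0
    · exact ⟨0, by simp [ha], by simp +contextual [ha]⟩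
    let q : K := ⟨(p, a), hp, ha⟩
    refine ⟨π q 1, ?_, fun x y h => hnorm q 1 x y ?_⟩
    · rw [← map_nsmul]
      simpa [q] using hrel q 1
    · intro e s he
      obtain ⟨n, rfl⟩ : ∃ n, e = 1 + n := by
        rcases e with _ | n
        · simp at he
          omega
        · exact ⟨n, add_comm _ _⟩
      simp only [multiplesHom_apply, q, add_nsmul, one_nsmul, ← add_assoc, h]
  · intro x y h
    omega
  · intro q e e' h
    have : q.1.1 ≠ 0 := q.2.1.ne'
    have : e = e' := by simpa [this] using h
    rw [this]
  · intro q e s e' h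
    simp only [nsmulAddMonoidHom_apply, smul_eq_mul] at h
    refine ⟨e' - e, ?_⟩
    simp only [nsmulAddMonoidHom_apply, smul_eq_mul, Nat.mul_sub]
    omega
  · intro q e h
    by_contra he
    exact q.2.2 (hM.eq_zero_of_nsmul_eq_zero he h)

theorem IsOrderEmbeddingHom.id (M : Type u) [AddCommMonoid M] :
    IsOrderEmbeddingHom (AddMonoidHom.id M) :=
  ⟨fun _ _ h => h, fun _ _ => Iff.rfl⟩

theorem IsOrderEmbeddingHom.comp {A B C : Type u} [AddCommMonoid A] [AddCommMonoid B]
    [AddCommMonoid C] {g : B →+ C} {f : A →+ B} (hg : IsOrderEmbeddingHom g)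
    (hf : IsOrderEmbeddingHom f) : IsOrderEmbeddingHom (g.comp f) :=
  ⟨hg.1.comp hf.1, fun x y => (hf.2 x y).trans (hg.2 (f x) (f y))⟩

/-- An order-embedding along which all refinement and normal division problems of the domain are
solved in the codomain. -/
structure IsSolvingExtension {M N : Type u} [AddCommMonoid M] [AddCommMonoid N] (j : M →+ N) :
    Prop where
  orderEmbedding : IsOrderEmbeddingHom j
  refinement : ∀ a₀ a₁ b₀ b₁ : M, a₀ + a₁ = b₀ + b₁ → ∃ c₀₀ c₀₁ c₁₀ c₁₁ : N,
    j a₀ = c₀₀ + c₀₁ ∧ j a₁ = c₁₀ + c₁₁ ∧ j b₀ = c₀₀ + c₁₀ ∧ j b₁ = c₀₁ + c₁₁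
  division : ∀ p : ℕ, 0 < p → ∀ a : M, ∃ u : N, p • u = j a ∧
    ∀ x y : M, x + a = y + a → j x + u = j y + u

theorem IsConical.exists_solvingExtension {M : Type u} [AddCommMonoid M] (hM : IsConical M) :
    ∃ (N : Type u) (_ : AddCommMonoid N) (j : M →+ N), IsConical N ∧ IsSolvingExtension j := by
  obtain ⟨N₁, _, j₁, hN₁, hj₁, href⟩ := hM.exists_refinement_extension
  obtain ⟨N₂, _, j₂, hN₂, hj₂, hdiv⟩ := hN₁.exists_division_extension
  refine ⟨N₂, _, j₂.comp j₁, hN₂, hj₂.comp hj₁, fun a₀ a₁ b₀ b₁ h => ?_, fun p hp a => ?_⟩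
  · obtain ⟨c₀₀, c₀₁, c₁₀, c₁₁, h₁, h₂, h₃, h₄⟩ := href a₀ a₁ b₀ b₁ h
    exact ⟨j₂ c₀₀, j₂ c₀₁, j₂ c₁₀, j₂ c₁₁, by simp [h₁], by simp [h₂], by simp [h₃], by simp [h₄]⟩
  · obtain ⟨u, hu, hu'⟩ := hdiv p hp (j₁ a)
    exact ⟨u, hu, fun x y h => hu' _ _ (by rw [← map_add, h, map_add])⟩

/-- A bundled conical commutative monoid. -/
structure ConicalMonoid : Type (u + 1) where
  carrier : Type u
  [addCommMonoid : AddCommMonoid carrier]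
  conical : IsConical carrier

attribute [instance] ConicalMonoid.addCommMonoid

/-- The union of a chain of embeddings of commutative monoids indexed by `ℕ`. -/
theorem exists_chain_union (G : ℕ → Type u) [∀ n, AddCommMonoid (G n)]
    (f : ∀ n, G n →+ G (n + 1)) (hf : ∀ n, Function.Injective (f n)) :
    ∃ (N : Type u) (_ : AddCommMonoid N) (i : ∀ n, G n →+ N),
      (∀ n, Function.Injective (i n)) ∧ (∀ n x, i (n + 1) (f n x) = i n x) ∧
        ∀ y, ∃ n x, i n x = y := by
  let F : ∀ m n : ℕ, m ≤ n → G m →+ G n := fun m n h =>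
    Nat.leRecOn h (fun {k} g => (f k).comp g) (AddMonoidHom.id _)
  have Fself : ∀ m, F m m le_rfl = AddMonoidHom.id _ := fun m => Nat.leRecOn_self _
  have Fsucc : ∀ m n (h : m ≤ n), F m (n + 1) (h.trans n.le_succ) = (f n).comp (F m n h) :=
    fun m n h => Nat.leRecOn_succ h _
  have Fmap : ∀ k m (hkm : k ≤ m) n (hmn : m ≤ n) (x : G k),
      F m n hmn (F k m hkm x) = F k n (hkm.trans hmn) x := by
    intro k m hkm n hmn x
    induction n, hmn using Nat.le_induction with
    | base => rw [Fself]; rfl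
    | succ n hmn ih => rw [Fsucc m n hmn, Fsucc k n (hkm.trans hmn)]; simp [ih]
  have Finj : ∀ m n (h : m ≤ n), Function.Injective (F m n h) := by
    intro m n h
    induction n, h using Nat.le_induction with
    | base => rw [Fself]; exact fun _ _ h => h
    | succ n h ih => rw [Fsucc m n h]; exact (hf n).comp ih
  have : DirectedSystem G (F · · ·) :=
    ⟨fun m x => by rw [Fself]; rfl, fun n m k hkm hmn x => Fmap _ _ hkm _ hmn x⟩
  refine ⟨DirectLimit G F, inferInstance, fun n =>
    { toFun := fun x => ⟦⟨n, x⟩⟧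
      map_zero' := (DirectLimit.zero_def n).symm
      map_add' := fun x y => (DirectLimit.add_def n x y).symm }, ?_, ?_, ?_⟩
  · exact fun n => DirectLimit.mk_injective F Finj n
  · intro n x
    have h := DirectLimit.mk_apply (f := F) n (n + 1) x n.le_succ
    rw [Fsucc n n le_rfl, Fself] at h
    exact h
  · intro y
    obtain ⟨n, x, rfl⟩ := DirectLimit.exists_eq_mk F y
    exact ⟨n, x, rfl⟩

/-- Every conical monoid order-embeds into a normally divisible conical refinement monoid. -/
theorem IsConical.exists_normallyDivisible_refinement {M : Type u} [AddCommMonoid M]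
    (hM : IsConical M) :
    ∃ (N : Type u) (_ : AddCommMonoid N), IsConical N ∧ IsNormallyDivisible N ∧
      IsRefinementMonoid N ∧ ∃ f : M →+ N, IsOrderEmbeddingHom f := by
  have hstep : ∀ C : ConicalMonoid.{u}, ∃ (D : ConicalMonoid.{u}) (j : C.carrier →+ D.carrier),
      IsSolvingExtension j := fun C => by
    obtain ⟨N, _, j, hN, hj⟩ := C.conical.exists_solvingExtension
    exact ⟨⟨N, hN⟩, j, hj⟩
  choose next f hf using hstep
  obtain ⟨C, f, hC, e, he⟩ : ∃ (C : ℕ → ConicalMonoid.{u})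
      (f : ∀ n, (C n).carrier →+ (C (n + 1)).carrier), (∀ n, IsSolvingExtension (f n)) ∧
        ∃ e : M →+ (C 0).carrier, IsOrderEmbeddingHom e :=
    ⟨fun n => Nat.rec (motive := fun _ => ConicalMonoid.{u}) ⟨M, hM⟩ (fun _ D => next D) n,
      fun n => f _, fun n => hf _, AddMonoidHom.id M, IsOrderEmbeddingHom.id M⟩
  obtain ⟨N, _, i, hinj, hcomp, hsurj⟩ := exists_chain_union (fun n => (C n).carrier)
    f (fun n => (hC n).orderEmbedding.1)
  have hmono : ∀ m n, m ≤ n → ∃ g : (C m).carrier →+ (C n).carrier,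
      IsOrderEmbeddingHom g ∧ ∀ x : (C m).carrier, i n (g x) = i m x := by
    intro m n h
    induction n, h using Nat.le_induction with
    | base => exact ⟨AddMonoidHom.id _, .id _, fun _ => rfl⟩
    | succ n h ih =>
      obtain ⟨g, hg, hg'⟩ := ih
      exact ⟨_, (hC n).orderEmbedding.comp hg, fun x => (hcomp n (g x)).trans (hg' x)⟩
  have hlift : ∀ m n, m ≤ n → ∀ x : N, x ∈ Set.range (i m) → x ∈ Set.range (i n) := by
    rintro m n h _ ⟨x, rfl⟩
    obtain ⟨g, -, hg⟩ := hmono m n h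
    exact ⟨g x, hg x⟩
  have hfin : ∀ X : Finset N, ∃ n, ∀ x ∈ X, x ∈ Set.range (i n) := by
    classical
    intro X
    induction X using Finset.induction_on with
    | empty => exact ⟨0, by simp⟩
    | insert a X _ ih =>
      obtain ⟨n, hn⟩ := ih
      obtain ⟨m, x, hx⟩ := hsurj a
      refine ⟨max m n, fun y hy => ?_⟩
      rcases Finset.mem_insert.1 hy with rfl | hy
      · exact hlift m _ (le_max_left _ _) _ ⟨x, hx⟩
      · exact hlift n _ (le_max_right _ _) _ (hn y hy)
  refine ⟨N, inferInstance, ?_, ?_, ?_, (i 0).comp e, (hinj 0).comp he.1, fun x y => ⟨?_, ?_⟩⟩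
  · classical
    intro x y h
    obtain ⟨n, hn⟩ := hfin {x, y}
    obtain ⟨x, rfl⟩ := hn x (by simp)
    obtain ⟨y, rfl⟩ := hn y (by simp)
    rw [← map_add, ← map_zero (i n)] at h
    obtain ⟨rfl, rfl⟩ := (C n).conical x y (hinj n h)
    simp
  · classical
    intro p hp X a
    obtain ⟨n, hn⟩ := hfin (insert a X)
    obtain ⟨a, rfl⟩ := hn a (by simp)
    obtain ⟨u, hu, hu'⟩ := (hC n).division p hp a
    refine ⟨i (n + 1) u, by rw [← map_nsmul, hu, hcomp], fun x hx y hy h => ?_⟩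
    obtain ⟨x, rfl⟩ := hn x (by simp [hx])
    obtain ⟨y, rfl⟩ := hn y (by simp [hy])
    rw [← map_add, ← map_add] at h
    rw [← hcomp n x, ← hcomp n y, ← map_add, ← map_add, hu' x y (hinj n h)]
  · classical
    intro a₀ a₁ b₀ b₁ h
    obtain ⟨n, hn⟩ := hfin {a₀, a₁, b₀, b₁}
    obtain ⟨a₀, rfl⟩ := hn a₀ (by simp)
    obtain ⟨a₁, rfl⟩ := hn a₁ (by simp)
    obtain ⟨b₀, rfl⟩ := hn b₀ (by simp)
    obtain ⟨b₁, rfl⟩ := hn b₁ (by simp)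
    rw [← map_add, ← map_add] at h
    obtain ⟨c₀₀, c₀₁, c₁₀, c₁₁, h₁, h₂, h₃, h₄⟩ := (hC n).refinement _ _ _ _ (hinj n h)
    refine ⟨i (n + 1) c₀₀, i (n + 1) c₀₁, i (n + 1) c₁₀, i (n + 1) c₁₁, ?_, ?_, ?_, ?_⟩ <;>
      rw [← map_add, ← hcomp]
    exacts [congrArg _ h₁, congrArg _ h₂, congrArg _ h₃, congrArg _ h₄]
  · rintro ⟨z, rfl⟩
    exact ⟨_, (map_add _ _ _).symm⟩
  · rintro ⟨z, h⟩
    obtain ⟨n, z, rfl⟩ := hsurj z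
    obtain ⟨g, hg, hg'⟩ := hmono 0 n n.zero_le
    refine ((hg.comp he).2 x y).2 ⟨z, hinj n ?_⟩
    simpa [hg'] using h

section Localization

variable {M : Type u} [AddCommMonoid M] (S : Submonoid ℕ)

theorem LocalizedModule.mk_add_mk_same (x y : M) (s : S) :
    LocalizedModule.mk x s + LocalizedModule.mk y s = LocalizedModule.mk (x + y) s := by
  rw [LocalizedModule.mk_add_mk, LocalizedModule.mk_eq]
  refine ⟨1, ?_⟩
  simp [smul_add, mul_smul]

/-- Clearing denominators. -/
theorem LocalizedModule.exists_mk_eq_of_finset (X : Finset (LocalizedModule S M)) :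
    ∃ s : S, ∀ x ∈ X, ∃ m : M, x = LocalizedModule.mk m s := by
  classical
  induction X using Finset.induction_on with
  | empty => exact ⟨1, by simp⟩
  | insert a X _ ih =>
    obtain ⟨s, hs⟩ := ih
    induction a using LocalizedModule.induction_on with | _ a t =>
    refine ⟨s * t, fun x hx => ?_⟩
    rcases Finset.mem_insert.1 hx with rfl | hx
    · exact ⟨s • a, (LocalizedModule.mk_cancel_common_left _ _ _).symm⟩
    · obtain ⟨m, rfl⟩ := hs x hx
      exact ⟨t • m, (LocalizedModule.mk_cancel_common_right _ _ _).symm⟩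

theorem LocalizedModule.mk_eq_mk_same_iff {x y : M} {s : S} :
    LocalizedModule.mk x s = LocalizedModule.mk y s ↔ ∃ t : S, t • x = t • y := by
  rw [LocalizedModule.mk_eq]
  constructor
  · rintro ⟨u, h⟩
    exact ⟨u * s, by rwa [mul_smul, mul_smul]⟩
  · rintro ⟨t, h⟩
    exact ⟨t, by rw [smul_comm t s, h, smul_comm t s]⟩

theorem IsConical.localizedModule (hM : IsConical M) (hS : ∀ s ∈ S, s ≠ 0) :
    IsConical (LocalizedModule S M) := by
  classical
  intro x y h
  obtain ⟨s, hs⟩ := LocalizedModule.exists_mk_eq_of_finset S {x, y}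
  obtain ⟨x, rfl⟩ := hs x (by simp)
  obtain ⟨y, rfl⟩ := hs y (by simp)
  rw [LocalizedModule.mk_add_mk_same, ← LocalizedModule.zero_mk s,
    LocalizedModule.mk_eq_mk_same_iff] at h
  obtain ⟨t, ht⟩ := h
  rw [smul_zero] at ht
  obtain ⟨rfl, rfl⟩ := hM _ _ (hM.eq_zero_of_nsmul_eq_zero (hS t t.2) ht)
  simp

theorem IsRefinementMonoid.localizedModule (hM : IsRefinementMonoid M) :
    IsRefinementMonoid (LocalizedModule S M) := by
  classical
  intro a₀ a₁ b₀ b₁ h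
  obtain ⟨s, hs⟩ := LocalizedModule.exists_mk_eq_of_finset S {a₀, a₁, b₀, b₁}
  obtain ⟨a₀, rfl⟩ := hs a₀ (by simp)
  obtain ⟨a₁, rfl⟩ := hs a₁ (by simp)
  obtain ⟨b₀, rfl⟩ := hs b₀ (by simp)
  obtain ⟨b₁, rfl⟩ := hs b₁ (by simp)
  rw [LocalizedModule.mk_add_mk_same, LocalizedModule.mk_add_mk_same,
    LocalizedModule.mk_eq_mk_same_iff] at h
  obtain ⟨t, ht⟩ := h
  rw [smul_add, smul_add] at ht
  obtain ⟨c₀₀, c₀₁, c₁₀, c₁₁, h₁, h₂, h₃, h₄⟩ := hM _ _ _ _ ht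
  refine ⟨.mk c₀₀ (t * s), .mk c₀₁ (t * s), .mk c₁₀ (t * s), .mk c₁₁ (t * s), ?_⟩
  simp only [LocalizedModule.mk_add_mk_same, ← h₁, ← h₂, ← h₃, ← h₄,
    LocalizedModule.mk_cancel_common_left, and_self]

theorem nsmul_localizedModule_mk (n : ℕ) (x : M) (s : S) :
    n • LocalizedModule.mk x s = LocalizedModule.mk (n • x) s := by
  induction n with
  | zero => simp
  | succ n ih => rw [succ_nsmul, succ_nsmul, ih, LocalizedModule.mk_add_mk_same]

theorem IsNormallyDivisible.localizedModule (hM : IsNormallyDivisible M) :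
    IsNormallyDivisible (LocalizedModule S M) := by
  classical
  intro p hp X a
  obtain ⟨s, hs⟩ := LocalizedModule.exists_mk_eq_of_finset S (insert a X)
  obtain ⟨a, rfl⟩ := hs a (by simp)
  choose! m hm using fun x (hx : x ∈ X) => hs x (by simp [hx])
  have hcommon : ∃ t : S, ∀ q ∈ X ×ˢ X, (∃ r : S, r • (m q.1 + a) = r • (m q.2 + a)) →
      t • (m q.1 + a) = t • (m q.2 + a) := by
    generalize X ×ˢ X = Y
    induction Y using Finset.induction_on with
    | empty => exact ⟨1, by simp⟩
    | insert b Y _ ih =>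
      obtain ⟨t, ht⟩ := ih
      by_cases hb : ∃ r : S, r • (m b.1 + a) = r • (m b.2 + a)
      · obtain ⟨r, hr⟩ := hb
        refine ⟨t * r, fun q hq h => ?_⟩
        rcases Finset.mem_insert.1 hq with rfl | hq
        · rw [mul_smul, mul_smul, hr]
        · rw [mul_comm, mul_smul, mul_smul, ht q hq h]
      · refine ⟨t, fun q hq h => ?_⟩
        rcases Finset.mem_insert.1 hq with rfl | hq
        · exact absurd h hb
        · exact ht q hq h
  obtain ⟨t, ht⟩ := hcommon
  obtain ⟨u, hu, hu'⟩ := hM p hp (X.image fun x => t • m x) (t • a)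
  refine ⟨.mk u (t * s), ?_, fun x hx y hy h => ?_⟩
  · rw [nsmul_localizedModule_mk, hu, LocalizedModule.mk_cancel_common_left]
  · rw [hm x hx, hm y hy, LocalizedModule.mk_add_mk_same, LocalizedModule.mk_add_mk_same,
      LocalizedModule.mk_eq_mk_same_iff] at h
    have h' := ht (x, y) (Finset.mk_mem_product hx hy) h
    rw [smul_add, smul_add] at h'
    rw [hm x hx, hm y hy, ← LocalizedModule.mk_cancel_common_left t s (m x),
      ← LocalizedModule.mk_cancel_common_left t s (m y), LocalizedModule.mk_add_mk_same,
      LocalizedModule.mk_add_mk_same, hu' _ (Finset.mem_image_of_mem _ hx) _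
        (Finset.mem_image_of_mem _ hy) h']

theorem pTorsionFree_localizedModule : PTorsionFree S (LocalizedModule S M) := by
  classical
  intro p hp x y h
  obtain ⟨s, hs⟩ := LocalizedModule.exists_mk_eq_of_finset S {x, y}
  obtain ⟨x, rfl⟩ := hs x (by simp)
  obtain ⟨y, rfl⟩ := hs y (by simp)
  rw [nsmul_localizedModule_mk, nsmul_localizedModule_mk, LocalizedModule.mk_eq_mk_same_iff] at h
  rw [LocalizedModule.mk_eq_mk_same_iff]
  obtain ⟨t, ht⟩ := h
  exact ⟨t * ⟨p, hp⟩, by rw [mul_smul, mul_smul]; exact ht⟩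

theorem pUnperforated_localizedModule : PUnperforated S (LocalizedModule S M) := by
  rintro p hp x y ⟨z, h⟩
  induction z using LocalizedModule.induction_on with | _ z s =>
  refine ⟨.mk z (⟨p, hp⟩ * s), pTorsionFree_localizedModule S p hp _ _ ?_⟩
  rw [nsmul_add, nsmul_localizedModule_mk]
  have h' : LocalizedModule.mk (p • z) (⟨p, hp⟩ * s) = LocalizedModule.mk z s :=
    LocalizedModule.mk_cancel_common_left (⟨p, hp⟩ : S) s z
  rw [h', h]

end Localization

/-- If `M` is torsion-free and unperforated with respect to `S`, then any order-embedding of `M`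
into `N` remains one after localizing `N` at `S`. -/
theorem IsOrderEmbeddingHom.localizedModule {M N : Type u} [AddCommMonoid M] [AddCommMonoid N]
    {S : Submonoid ℕ} (htf : PTorsionFree S M) (hunp : PUnperforated S M) {f : M →+ N}
    (hf : IsOrderEmbeddingHom f) :
    IsOrderEmbeddingHom ((LocalizedModule.mkLinearMap S N).toAddMonoidHom.comp f) := by
  refine ⟨fun x y h => ?_, fun x y => ⟨?_, ?_⟩⟩
  · have h : LocalizedModule.mk (f x) (1 : S) = LocalizedModule.mk (f y) 1 := h
    obtain ⟨t, ht⟩ := (LocalizedModule.mk_eq_mk_same_iff S).1 h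
    have ht : (t : ℕ) • f x = (t : ℕ) • f y := ht
    rw [← map_nsmul, ← map_nsmul] at ht
    exact htf t t.2 _ _ (hf.1 ht)
  · rintro ⟨z, rfl⟩
    exact ⟨_, (map_add _ _ _).symm⟩
  · rintro ⟨z, h⟩
    induction z using LocalizedModule.induction_on with | _ z s =>
    have h : LocalizedModule.mk (f x) (1 : S) + LocalizedModule.mk z s =
      LocalizedModule.mk (f y) 1 := h
    rw [LocalizedModule.mk_add_mk, LocalizedModule.mk_eq] at h
    obtain ⟨t, ht⟩ := h
    have ht : (t : ℕ) • ((1 : ℕ) • ((s : ℕ) • f x + (1 : ℕ) • z)) =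
      (t : ℕ) • ((1 * s : ℕ) • f y) := ht
    rw [one_nsmul, one_nsmul, one_mul, smul_add] at ht
    refine hunp s s.2 x y (hunp t t.2 _ _ ((hf.2 _ _).2 ⟨(t : ℕ) • z, ?_⟩))
    simpa only [map_nsmul] using ht

theorem PTorsionFree.closure {P : Set ℕ} {M : Type u} [AddCommMonoid M] (h : PTorsionFree P M) :
    PTorsionFree (Submonoid.closure P : Set ℕ) M := by
  intro p hp
  induction hp using Submonoid.closure_induction with
  | mem p hp => exact h p hp
  | one => simp
  | mul p q _ _ ihp ihq =>
    intro x y hxy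
    rw [mul_nsmul', mul_nsmul'] at hxy
    exact ihq _ _ (ihp _ _ hxy)

theorem PUnperforated.closure {P : Set ℕ} {M : Type u} [AddCommMonoid M]
    (h : PUnperforated P M) : PUnperforated (Submonoid.closure P : Set ℕ) M := by
  intro p hp
  induction hp using Submonoid.closure_induction with
  | mem p hp => exact h p hp
  | one => simp
  | mul p q _ _ ihp ihq =>
    intro x y hxy
    rw [mul_nsmul', mul_nsmul'] at hxy
    exact ihq _ _ (ihp _ _ hxy)

/-- Every `ℙ`-torsion-free `ℙ`-unperforated cone admits an order-embedding
into a `ℙ`-torsion-free `ℙ`-unperforated normally divisible refinement cone. -/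
theorem PTorsionFree_PUnperforated_cone_orderEmbeds
    (P : Set ℕ) (hPpos : ∀ p ∈ P, 0 < p) (hPmul : ∀ p ∈ P, ∀ q ∈ P, p * q ∈ P)
    (M : Type u) [AddCommMonoid M] (hM : IsConical M)
    (hMtf : PTorsionFree P M) (hMunp : PUnperforated P M) :
    ∃ (N : Type u) (_ : AddCommMonoid N),
      IsConical N ∧ PTorsionFree P N ∧ PUnperforated P N ∧
      IsNormallyDivisible N ∧ IsRefinementMonoid N ∧
      ∃ f : M →+ N, IsOrderEmbeddingHom f := by
  have hpos : ∀ s ∈ Submonoid.closure P, s ≠ 0 := fun s hs => by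
    induction hs using Submonoid.closure_induction with
    | mem p hp => exact (hPpos p hp).ne'
    | one => exact one_ne_zero
    | mul p q _ _ hp hq => exact mul_ne_zero hp hq
  obtain ⟨N, _, hN, hdiv, href, f, hf⟩ := hM.exists_normallyDivisible_refinement
  exact ⟨LocalizedModule (Submonoid.closure P) N, inferInstance, hN.localizedModule _ hpos,
    fun p hp => pTorsionFree_localizedModule _ p (Submonoid.subset_closure hp),
    fun p hp => pUnperforated_localizedModule _ p (Submonoid.subset_closure hp),
    hdiv.localizedModule _, href.localizedModule _, _, hf.localizedModule hMtf.closure hMunp.closure⟩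
end

section
/- In a refinement monoid, every ≍-equivalence class is downward directed: if a ≍ b in a refinement monoid M, then there exists c ∈ M with c ≤ a, c ≤ b, and c ≍ a. -/
universe u

/-- In a refinement monoid, two lower bounds of the common element `b` have an upper bound below both
`b` and their sum. -/
theorem IsRefinementMonoid.exists_common_upper_bound {M : Type u} [AddCommMonoid M]
    (hM : IsRefinementMonoid M) {x y b : M} (hx : AlgLE x b) (hy : AlgLE y b) :
    ∃ c : M, AlgLE x c ∧ AlgLE y c ∧ AlgLE c b ∧ AlgLE c (x + y) := by
  obtain ⟨x', hx⟩ := hx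
  obtain ⟨y', hy⟩ := hy
  obtain ⟨p, q, r, s, rfl, rfl, rfl, rfl⟩ := hM x x' y y' (hx.trans hy.symm)
  exact ⟨p + q + r, ⟨r, rfl⟩, ⟨q, by abel⟩, ⟨s, by rw [← hx]; abel⟩, ⟨p, by abel⟩⟩

/-- In a refinement monoid, if `a ≤ n • b`, then some `c ≤ a, b` satisfies `a ∝ c`. -/
theorem IsRefinementMonoid.exists_common_lower_bound {M : Type u} [AddCommMonoid M]
    (hM : IsRefinementMonoid M) (b : M) (n : ℕ) (a : M) (h : AlgLE a (n • b)) :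
    ∃ c : M, AlgLE c a ∧ AlgLE c b ∧ Propto a c := by
  induction n generalizing a with
  | zero =>
    obtain ⟨z, hz⟩ := h
    refine ⟨a, ⟨0, add_zero a⟩, ⟨z + b, ?_⟩, 1, one_pos, 0, by simp⟩
    rw [← add_assoc, hz, zero_smul, zero_add]
  | succ n ih =>
    obtain ⟨z, hz⟩ := h
    rw [succ_nsmul] at hz
    obtain ⟨a₀, a₁, z₀, z₁, rfl, -, h₀, h₁⟩ := hM a z (n • b) b hz
    obtain ⟨d, ⟨e, he⟩, hdb, k, -, f, hf⟩ := ih a₀ ⟨z₀, h₀.symm⟩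
    obtain ⟨c, ⟨u, hu⟩, ⟨v, hv⟩, hcb, w, hw⟩ :=
      hM.exists_common_upper_bound hdb ⟨z₁, h₁.symm⟩
    refine ⟨c, ⟨w + e, ?_⟩, hcb, k + 1, k.succ_pos, f + k • u + v, ?_⟩
    · rw [← add_assoc, hw, add_right_comm, he]
    · calc a₀ + a₁ + (f + k • u + v) = (a₀ + f) + k • u + (a₁ + v) := by abel
        _ = (k + 1) • c := by rw [hf, hv, ← nsmul_add, hu, succ_nsmul]

/-- In a refinement monoid, every `≍`-equivalence class is downward
directed. -/
theorem asymp_class_downward_directed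
    (M : Type u) [AddCommMonoid M] (hM : IsRefinementMonoid M)
    (a b : M) (hab : Asymp a b) :
    ∃ c : M, AlgLE c a ∧ AlgLE c b ∧ Asymp c a := by
  obtain ⟨⟨n, -, h⟩, -⟩ := hab
  obtain ⟨c, hca, hcb, hac⟩ := hM.exists_common_lower_bound b n a h
  exact ⟨c, hca, hcb, ⟨1, one_pos, by rwa [one_smul]⟩, hac⟩
end

section
/- Let M be a cone and a ∈ M. Then M(a) is a submonoid of M which is a simple cone. If, in addition, M is a normally divisible refinement cone, then M(a) is a simple normally divisible refinement cone. -/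
universe u

section AlgebraicPreorder

variable {M : Type u} [AddCommMonoid M]

theorem AlgLE.refl (x : M) : AlgLE x x := ⟨0, add_zero x⟩

theorem AlgLE.trans {x y z : M} (hxy : AlgLE x y) (hyz : AlgLE y z) : AlgLE x z := by
  obtain ⟨u, rfl⟩ := hxy
  obtain ⟨v, rfl⟩ := hyz
  exact ⟨u + v, by abel⟩

theorem AlgLE.add {x y z w : M} (hxy : AlgLE x y) (hzw : AlgLE z w) :
    AlgLE (x + z) (y + w) := by
  obtain ⟨u, rfl⟩ := hxy
  obtain ⟨v, rfl⟩ := hzw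
  exact ⟨u + v, by abel⟩

theorem algLE_add_right (x y : M) : AlgLE x (x + y) := ⟨y, rfl⟩

theorem algLE_add_left (x y : M) : AlgLE x (y + x) := ⟨y, add_comm x y⟩

theorem AlgLE.nsmul {x y : M} (h : AlgLE x y) (n : ℕ) : AlgLE (n • x) (n • y) := by
  obtain ⟨u, rfl⟩ := h
  exact ⟨n • u, (smul_add n x u).symm⟩

theorem algLE_nsmul {p : ℕ} (hp : 0 < p) (x : M) : AlgLE x (p • x) := by
  obtain ⟨q, rfl⟩ := Nat.exists_eq_succ_of_ne_zero hp.ne'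
  exact ⟨q • x, (succ_nsmul' x q).symm⟩

theorem AlgLE.propto {x y : M} (h : AlgLE x y) : Propto x y :=
  ⟨1, one_pos, by rwa [one_nsmul]⟩

theorem Propto.trans {x y z : M} (hxy : Propto x y) (hyz : Propto y z) : Propto x z := by
  obtain ⟨n, hn, h⟩ := hxy
  obtain ⟨m, hm, h'⟩ := hyz
  exact ⟨n * m, Nat.mul_pos hn hm, mul_nsmul' z n m ▸ h.trans (h'.nsmul n)⟩

theorem Propto.add {x y z : M} (hx : Propto x z) (hy : Propto y z) : Propto (x + y) z := by
  obtain ⟨n, hn, h⟩ := hx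
  obtain ⟨m, -, h'⟩ := hy
  exact ⟨n + m, Nat.add_pos_left hn m, add_nsmul z n m ▸ h.add h'⟩

theorem propto_nsmul_left {p : ℕ} (hp : 0 < p) (x : M) : Propto (p • x) x :=
  ⟨p, hp, .refl _⟩

end AlgebraicPreorder

section Refinement

variable {M : Type u} [AddCommMonoid M]

/-- Riesz decomposition in a refinement monoid. -/
theorem IsRefinementMonoid.exists_add_of_algLE_add (hR : IsRefinementMonoid M) {t x y : M}
    (h : AlgLE t (x + y)) : ∃ t₀ t₁, t = t₀ + t₁ ∧ AlgLE t₀ x ∧ AlgLE t₁ y := by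
  obtain ⟨z, hz⟩ := h
  obtain ⟨c₀₀, c₀₁, c₁₀, c₁₁, rfl, -, rfl, rfl⟩ := hR _ _ _ _ hz
  exact ⟨c₀₀, c₀₁, rfl, algLE_add_right _ _, algLE_add_right _ _⟩

/-- Two common lower bounds of `c` and `d` are, up to multiples, below a single one. -/
theorem IsRefinementMonoid.exists_common_lower_bound_s10 (hR : IsRefinementMonoid M)
    {c d s t : M} (hsc : AlgLE s c) (hsd : AlgLE s d) (htc : AlgLE t c) (htd : AlgLE t d) :
    ∃ h, AlgLE h c ∧ AlgLE h d ∧ Propto s h ∧ Propto t h := by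
  obtain ⟨r, rfl⟩ := hsc
  obtain ⟨r', rfl⟩ := hsd
  obtain ⟨t₀, t₁, rfl, ht₀, ht₁⟩ := hR.exists_add_of_algLE_add htc
  obtain ⟨k₀, k₁, rfl, hk₀, hk₁⟩ :=
    hR.exists_add_of_algLE_add ((algLE_add_left t₁ t₀).trans htd)
  have hs : Propto s (s + k₁) := (algLE_add_right s k₁).propto
  exact ⟨s + k₁, (AlgLE.refl s).add ((algLE_add_left k₁ k₀).trans ht₁), (AlgLE.refl s).add hk₁,
    hs, (ht₀.propto.trans hs).add ((hk₀.propto.trans hs).add (algLE_add_left k₁ s).propto)⟩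

/-- A sum of two elements that are, up to multiples, below common lower bounds of `c` and `d`
has the same property. -/
theorem IsRefinementMonoid.exists_propto_add (hR : IsRefinementMonoid M) {c d s t : M}
    (hs : ∃ h, AlgLE h c ∧ AlgLE h d ∧ Propto s h)
    (ht : ∃ h, AlgLE h c ∧ AlgLE h d ∧ Propto t h) :
    ∃ h, AlgLE h c ∧ AlgLE h d ∧ Propto (s + t) h := by
  obtain ⟨h₀, h₀c, h₀d, hs⟩ := hs
  obtain ⟨h₁, h₁c, h₁d, ht⟩ := ht
  obtain ⟨h, hc, hd, h₀h, h₁h⟩ := hR.exists_common_lower_bound_s10 h₀c h₀d h₁c h₁d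
  exact ⟨h, hc, hd, (hs.trans h₀h).add (ht.trans h₁h)⟩

theorem IsRefinementMonoid.exists_propto_of_algLE_nsmul (hR : IsRefinementMonoid M)
    {c d : M} (n m : ℕ) {t : M} (hc : AlgLE t (n • c)) (hd : AlgLE t (m • d)) :
    ∃ h, AlgLE h c ∧ AlgLE h d ∧ Propto t h := by
  have zero {t : M} (h : AlgLE t 0) : ∃ h, AlgLE h c ∧ AlgLE h d ∧ Propto t h :=
    ⟨0, ⟨c, zero_add c⟩, ⟨d, zero_add d⟩, h.propto⟩
  induction n generalizing t with
  | zero => exact zero (by rwa [zero_nsmul] at hc)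
  | succ n ihn =>
    rw [succ_nsmul] at hc
    obtain ⟨t₀, t₁, rfl, ht₀, ht₁⟩ := hR.exists_add_of_algLE_add hc
    refine hR.exists_propto_add (ihn ht₀ ((algLE_add_right t₀ t₁).trans hd)) ?_
    replace hd := (algLE_add_left t₁ t₀).trans hd
    clear ihn hc ht₀
    induction m generalizing t₁ with
    | zero => exact zero (by rwa [zero_nsmul] at hd)
    | succ m ihm =>
      rw [succ_nsmul] at hd
      obtain ⟨k₀, k₁, rfl, hk₀, hk₁⟩ := hR.exists_add_of_algLE_add hd
      exact hR.exists_propto_add (ihm k₀ ((algLE_add_right k₀ k₁).trans ht₁) hk₀)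
        ⟨k₁, (algLE_add_left k₁ k₀).trans ht₁, hk₁, (AlgLE.refl k₁).propto⟩

theorem IsRefinementMonoid.exists_propto_add_of_propto (hR : IsRefinementMonoid M)
    {a b c d : M} (hc : Propto a (b + c)) (hd : Propto a (b + d)) :
    ∃ h, AlgLE h c ∧ AlgLE h d ∧ Propto a (b + h) := by
  obtain ⟨n, hn, hc⟩ := hc
  obtain ⟨m, hm, hd⟩ := hd
  rw [smul_add] at hc hd
  obtain ⟨t₀, t₁, rfl, ht₀, ht₁⟩ := hR.exists_add_of_algLE_add hc
  obtain ⟨k₀, k₁, rfl, hk₀, hk₁⟩ :=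
    hR.exists_add_of_algLE_add ((algLE_add_left t₁ t₀).trans hd)
  obtain ⟨h, hhc, hhd, hk₁h⟩ :=
    hR.exists_propto_of_algLE_nsmul n m ((algLE_add_left k₁ k₀).trans ht₁) hk₁
  have hb : Propto b (b + h) := (algLE_add_right b h).propto
  have ht₀b : Propto t₀ b := ⟨n, hn, ht₀⟩
  have hk₀b : Propto k₀ b := ⟨m, hm, hk₀⟩
  exact ⟨h, hhc, hhd,
    (ht₀b.trans hb).add ((hk₀b.trans hb).add (hk₁h.trans (algLE_add_left h b).propto))⟩

/-- A refinement matrix all of whose row and column sums dominate `a` up to multiples can be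
changed, without changing these sums and without losing any entry up to multiples, so that its
diagonal entries dominate `a` up to multiples. -/
theorem IsRefinementMonoid.exists_propto_diagonal (hR : IsRefinementMonoid M)
    (hD : IsNormallyDivisible M) {a c₀₀ c₀₁ c₁₀ c₁₁ : M}
    (h₀ : Propto a (c₀₀ + c₀₁)) (h₁ : Propto a (c₁₀ + c₁₁))
    (h₀' : Propto a (c₀₀ + c₁₀)) (h₁' : Propto a (c₀₁ + c₁₁)) :
    ∃ e₀₀ e₀₁ e₁₀ e₁₁ : M,
      c₀₀ + c₀₁ = e₀₀ + e₀₁ ∧ c₁₀ + c₁₁ = e₁₀ + e₁₁ ∧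
      c₀₀ + c₁₀ = e₀₀ + e₁₀ ∧ c₀₁ + c₁₁ = e₀₁ + e₁₁ ∧
      Propto a e₀₀ ∧ Propto a e₁₁ ∧ Propto c₀₁ e₀₁ ∧ Propto c₁₀ e₁₀ := by
  rw [add_comm] at h₁ h₁'
  obtain ⟨s, hs₀, hs₁, hs⟩ := hR.exists_propto_add_of_propto h₀ h₀'
  obtain ⟨t, ht₀, ht₁, ht⟩ := hR.exists_propto_add_of_propto h₁' h₁
  obtain ⟨h, ⟨r, rfl⟩, ⟨r', rfl⟩, hsh, hth⟩ := hR.exists_common_lower_bound_s10 hs₀ hs₁ ht₀ ht₁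
  obtain ⟨g, rfl, -⟩ := hD 2 two_pos ∅ h
  have hg : Propto (2 • g) g := propto_nsmul_left two_pos g
  have key (b x : M) (hx : Propto x (2 • g)) : Propto (b + x) (b + g) :=
    (algLE_add_right b g).propto.add ((hx.trans hg).trans (algLE_add_left g b).propto)
  have half (r : M) : Propto (2 • g + r) (g + r) :=
    (hg.trans (algLE_add_right g r).propto).add (algLE_add_left r g).propto
  refine ⟨c₀₀ + g, g + r, g + r', c₁₁ + g, ?_, ?_, ?_, ?_, hs.trans (key _ _ hsh),
    ht.trans (key _ _ hth), half r, half r'⟩ <;> rw [two_nsmul] <;> abel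

theorem IsRefinementMonoid.exists_refinement_propto (hR : IsRefinementMonoid M)
    (hD : IsNormallyDivisible M) {a a₀ a₁ b₀ b₁ : M} (h : a₀ + a₁ = b₀ + b₁)
    (h₀ : Propto a a₀) (h₁ : Propto a a₁) (h₀' : Propto a b₀) (h₁' : Propto a b₁) :
    ∃ c₀₀ c₀₁ c₁₀ c₁₁ : M,
      (a₀ = c₀₀ + c₀₁ ∧ a₁ = c₁₀ + c₁₁ ∧ b₀ = c₀₀ + c₁₀ ∧ b₁ = c₀₁ + c₁₁) ∧
      Propto a c₀₀ ∧ Propto a c₀₁ ∧ Propto a c₁₀ ∧ Propto a c₁₁ := by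
  obtain ⟨c₀₀, c₀₁, c₁₀, c₁₁, rfl, rfl, rfl, rfl⟩ := hR _ _ _ _ h
  obtain ⟨d₀₀, d₀₁, d₁₀, d₁₁, e₀, e₁, e₀', e₁', hd₀₀, hd₁₁, -, -⟩ :=
    hR.exists_propto_diagonal hD h₀ h₁ h₀' h₁'
  rw [e₀, add_comm] at h₀
  rw [e₁, add_comm] at h₁
  rw [e₀'] at h₀'
  rw [e₁'] at h₁'
  rw [e₀, e₁, e₀', e₁']
  obtain ⟨f₀₁, f₀₀, f₁₁, f₁₀, g₀, g₁, g₁', g₀', hf₀₁, hf₁₀, hf₀₀, hf₁₁⟩ :=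
    hR.exists_propto_diagonal hD h₀ h₁ h₁' h₀'
  exact ⟨f₀₀, f₀₁, f₁₀, f₁₁, ⟨by rw [add_comm, g₀, add_comm], by rw [add_comm, g₁, add_comm],
    g₀', g₁'⟩, hd₀₀.trans hf₀₀, hf₀₁, hf₁₀, hd₁₁.trans hf₁₁⟩

end Refinement

section LocalSubmonoid

variable {M : Type u} [AddCommMonoid M]

/-- The submonoid `M(a)` of all elements that are zero or `≍ a`. -/
def localSubmonoid (a : M) : AddSubmonoid M where
  carrier := {x : M | Asymp x a} ∪ {0}
  zero_mem' := Or.inr rfl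
  add_mem' := by
    rintro x y (hx | rfl) (hy | rfl)
    · exact Or.inl ⟨hx.1.add hy.1, hx.2.trans (algLE_add_right x y).propto⟩
    · exact Or.inl (by rwa [add_zero])
    · exact Or.inl (by rwa [zero_add])
    · exact Or.inr (add_zero 0)

theorem IsConical.addSubmonoid (hM : IsConical M) (S : AddSubmonoid M) : IsConical S := by
  intro x y h
  have := hM x y (by exact_mod_cast congrArg Subtype.val h)
  exact ⟨Subtype.ext this.1, Subtype.ext this.2⟩

theorem isSimpleMonoid_localSubmonoid (a : M) : IsSimpleMonoid (localSubmonoid a) := by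
  rintro ⟨u, hu | rfl⟩ hu0 ⟨x, hx⟩
  · have hxa : Propto x a := hx.elim And.left fun hx0 => ⟨1, one_pos, a, by
      rw [Set.mem_singleton_iff.1 hx0, zero_add, one_nsmul]⟩
    obtain ⟨n, hn, z, hz⟩ := hxa.trans hu.2
    have hzu : Propto (z + u) u :=
      ((algLE_add_left z x).propto.trans (hz ▸ propto_nsmul_left hn u)).add (AlgLE.refl u).propto
    refine ⟨n + 1, n.succ_pos,
      ⟨z + u, Or.inl ⟨hzu.trans hu.1, hu.2.trans (algLE_add_left u z).propto⟩⟩, Subtype.ext ?_⟩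
    change x + (z + u) = (n + 1) • u
    rw [← add_assoc, hz, succ_nsmul]
  · exact absurd (AlgLE.refl _) hu0

theorem IsConical.isNormallyDivisible_localSubmonoid (hM : IsConical M)
    (hD : IsNormallyDivisible M) (a : M) : IsNormallyDivisible (localSubmonoid a) := by
  classical
  rintro p hp X ⟨b, hb⟩
  obtain ⟨u, hpu, hu⟩ := hD p hp (X.image Subtype.val) b
  have hub : AlgLE u b := hpu ▸ algLE_nsmul hp u
  have hmem : u ∈ localSubmonoid a := by
    rcases hb with hb | hb
    · exact Or.inl ⟨hub.propto.trans hb.1, hb.2.trans (hpu ▸ propto_nsmul_left hp u)⟩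
    · obtain ⟨z, hz⟩ := hub
      exact Or.inr (hM u z (hz.trans hb)).1
  refine ⟨⟨u, hmem⟩, Subtype.ext hpu, fun x hx y hy hxy => Subtype.ext ?_⟩
  exact hu x (Finset.mem_image_of_mem _ hx) y (Finset.mem_image_of_mem _ hy)
    (congrArg Subtype.val hxy)

theorem IsRefinementMonoid.localSubmonoid (hR : IsRefinementMonoid M)
    (hD : IsNormallyDivisible M) (a : M) : IsRefinementMonoid (localSubmonoid a) := by
  intro a₀ a₁ b₀ b₁ h
  by_cases h₀ : a₀ = 0
  · exact ⟨0, 0, b₀, b₁, by simp [h₀], by simpa [h₀] using h, by simp, by simp⟩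
  by_cases h₁ : a₁ = 0
  · exact ⟨b₀, b₁, 0, 0, by simpa [h₁] using h, by simp [h₁], by simp, by simp⟩
  by_cases h₀' : b₀ = 0
  · exact ⟨0, a₀, 0, a₁, by simp, by simp, by simp [h₀'], by simpa [h₀'] using h.symm⟩
  by_cases h₁' : b₁ = 0
  · exact ⟨a₀, 0, a₁, 0, by simp, by simp, by simpa [h₁'] using h.symm, by simp [h₁']⟩
  have asymp {x : _root_.localSubmonoid a} (hx : x ≠ 0) : Asymp (x : M) a :=
    x.2.resolve_right fun h => hx (Subtype.ext h)
  obtain ⟨c₀₀, c₀₁, c₁₀, c₁₁, ⟨e₀, e₁, e₀', e₁'⟩, hc₀₀, hc₀₁, hc₁₀, hc₁₁⟩ :=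
    hR.exists_refinement_propto hD (congrArg Subtype.val h) (asymp h₀).2 (asymp h₁).2
      (asymp h₀').2 (asymp h₁').2
  have row₀ : Propto (c₀₀ + c₀₁) a := e₀ ▸ (asymp h₀).1
  have row₁ : Propto (c₁₀ + c₁₁) a := e₁ ▸ (asymp h₁).1
  exact ⟨⟨c₀₀, Or.inl ⟨(algLE_add_right _ _).propto.trans row₀, hc₀₀⟩⟩,
    ⟨c₀₁, Or.inl ⟨(algLE_add_left _ _).propto.trans row₀, hc₀₁⟩⟩,
    ⟨c₁₀, Or.inl ⟨(algLE_add_right _ _).propto.trans row₁, hc₁₀⟩⟩,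
    ⟨c₁₁, Or.inl ⟨(algLE_add_left _ _).propto.trans row₁, hc₁₁⟩⟩,
    Subtype.ext e₀, Subtype.ext e₁, Subtype.ext e₀', Subtype.ext e₁'⟩

end LocalSubmonoid

/-- For a cone `M` and `a ∈ M`, `M(a) = {x : x ≍ a} ∪ {0}` is a submonoid
of `M` which is a simple cone; and if `M` is moreover a normally divisible refinement
cone, then `M(a)` is a simple normally divisible refinement cone. -/
theorem local_submonoid_is_simple_cone
    (M : Type u) [AddCommMonoid M] (hM : IsConical M) (a : M) :
    ∃ S : AddSubmonoid M,
      (S : Set M) = {x : M | Asymp x a} ∪ {0} ∧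
      IsConical S ∧ IsSimpleMonoid S ∧
      (IsNormallyDivisible M → IsRefinementMonoid M →
        IsSimpleMonoid S ∧ IsNormallyDivisible S ∧ IsRefinementMonoid S) := by
  exact ⟨localSubmonoid a, rfl, hM.addSubmonoid _, isSimpleMonoid_localSubmonoid a,
    fun hD hR => ⟨isSimpleMonoid_localSubmonoid a, hM.isNormallyDivisible_localSubmonoid hD a,
      hR.localSubmonoid hD a⟩⟩
end
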